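/- Let A be a symmetric skew left brace. Then for all integers s ≥ r ≥ 1, all v ∈ Γ_r(A) and all u ∈ Ann_s(A), one has v*u ∈ Ann_{s-r}(A). -/

import Mathlib

set_option linter.unusedVariables false

universe u v

/-- A skew left brace: a carrier with two group structures `(A,·)` (written `dmul`) and
`(A,∘)` (written `cmul`) sharing the same identity `ident`, satisfying
`a ∘ (b · c) = (a ∘ b) · a⁻¹ · (a ∘ c)`. -/
class SkewBrace (A : Type u) where
  dmul : A → A → A
  ident : A
  dinv : A → A
  cmul : A → A → A
  cinv : A → A
  dmul_assoc : ∀ a b c : A, dmul (dmul a b) c = dmul a (dmul b c)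
  ident_dmul : ∀ a : A, dmul ident a = a
  dmul_ident : ∀ a : A, dmul a ident = a
  dinv_dmul : ∀ a : A, dmul (dinv a) a = ident
  dmul_dinv : ∀ a : A, dmul a (dinv a) = ident
  cmul_assoc : ∀ a b c : A, cmul (cmul a b) c = cmul a (cmul b c)
  ident_cmul : ∀ a : A, cmul ident a = a
  cmul_ident : ∀ a : A, cmul a ident = a
  cinv_cmul : ∀ a : A, cmul (cinv a) a = ident
  cmul_cinv : ∀ a : A, cmul a (cinv a) = ident
  compat : ∀ a b c : A, cmul a (dmul b c) = dmul (dmul (cmul a b) (dinv a)) (cmul a c)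

namespace SkewBrace

variable {A : Type u} [SkewBrace A]

/-- The lambda map `λ_a(b) = a⁻¹ · (a ∘ b)`. -/
def lam (a b : A) : A := dmul (dinv a) (cmul a b)

/-- The star operation `a * b = λ_a(b) · b⁻¹`. -/
def bstar (a b : A) : A := dmul (lam a b) (dinv b)

/-- The dot commutator `[a,b]· = a · b · a⁻¹ · b⁻¹`. -/
def dcomm (a b : A) : A := dmul (dmul (dmul a b) (dinv a)) (dinv b)

/-- The circle commutator `[a,b]∘ = a ∘ b ∘ ā ∘ b̄`. -/
def ccomm (a b : A) : A := cmul (cmul (cmul a b) (cinv a)) (cinv b)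

/-- Membership in the subgroup of `(A,·)` generated by a subset. -/
inductive dclosure (S : Set A) : A → Prop
  | mem {x : A} : x ∈ S → dclosure S x
  | one : dclosure S ident
  | mul {x y : A} : dclosure S x → dclosure S y → dclosure S (dmul x y)
  | inv {x : A} : dclosure S x → dclosure S (dinv x)

/-- The subgroup of `(A,·)` generated by a subset, as a set. -/
def dcl (S : Set A) : Set A := {x | dclosure S x}

/-- Membership in the subgroup of `(A,∘)` generated by a subset. -/
inductive cclosure (S : Set A) : A → Prop
  | mem {x : A} : x ∈ S → cclosure S x
  | one : cclosure S ident
  | mul {x y : A} : cclosure S x → cclosure S y → cclosure S (cmul x y)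
  | inv {x : A} : cclosure S x → cclosure S (cinv x)

/-- The subgroup of `(A,∘)` generated by a subset, as a set. -/
def ccl (S : Set A) : Set A := {x | cclosure S x}

/-- The set `{x * y : x ∈ I, y ∈ J}` (star values). -/
def starSet (I J : Set A) : Set A := {x | ∃ a ∈ I, ∃ b ∈ J, x = bstar a b}

/-- The set of dot commutators `[a,b]·` with `a ∈ I`, `b ∈ J`. -/
def dcommSet (I J : Set A) : Set A := {x | ∃ a ∈ I, ∃ b ∈ J, x = dcomm a b}

/-- The set of circle commutators `[a,b]∘` with `a ∈ I`, `b ∈ J`. -/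
def ccommSet (I J : Set A) : Set A := {x | ∃ a ∈ I, ∃ b ∈ J, x = ccomm a b}

/-- The lower central series `Γ_n(A)` of the skew brace `A` (`Gamma A n = Γ_n(A)` for `n ≥ 1`):
`Γ₁(A) = A` and `Γ_n(A) = ⟨A * Γ_{n-1}(A), Γ_{n-1}(A) * A, [A,Γ_{n-1}(A)]·⟩·`. -/
def Gamma (A : Type u) [SkewBrace A] : ℕ → Set A
  | 0 => Set.univ
  | 1 => Set.univ
  | (n+2) =>
      dcl (starSet Set.univ (Gamma A (n+1)) ∪ starSet (Gamma A (n+1)) Set.univ ∪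
        dcommSet Set.univ (Gamma A (n+1)))

/-- The lower central series `γ_n(A,∘)` of the group `(A,∘)`
(`gammaCirc A n = γ_n(A,∘)` for `n ≥ 1`). -/
def gammaCirc (A : Type u) [SkewBrace A] : ℕ → Set A
  | 0 => Set.univ
  | 1 => Set.univ
  | (n+2) => ccl (ccommSet (gammaCirc A (n+1)) Set.univ)

/-- The series `Γ̄_n(A)`: `Γ̄₁(A) = A`, `Γ̄_n(A) = ⟨A * Γ̄_{n-1}(A), [A, Γ̄_{n-1}(A)]·⟩·`. -/
def GammaBar (A : Type u) [SkewBrace A] : ℕ → Set A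
  | 0 => Set.univ
  | 1 => Set.univ
  | (n+2) =>
      dcl (starSet Set.univ (GammaBar A (n+1)) ∪ dcommSet Set.univ (GammaBar A (n+1)))

/-- The annihilator series: `AnnS A n = Ann_n(A)`, with `Ann_0(A) = 1` and
`Ann_n(A) = {a | a*b, b*a, [a,b]· ∈ Ann_{n-1}(A) for all b}`. -/
def AnnS (A : Type u) [SkewBrace A] : ℕ → Set A
  | 0 => {ident}
  | (n+1) => {a | ∀ b : A, bstar a b ∈ AnnS A n ∧ bstar b a ∈ AnnS A n ∧ dcomm a b ∈ AnnS A n}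

/-- The alphabet `X = {γ·, γ̄·, *, *̄}` of brace commutator symbols. -/
inductive BWord : Type
  | g | gbar | s | sbar

/-- Evaluation of a single symbol of `X`. -/
def evalX : BWord → A → A → A
  | BWord.g => dcomm
  | BWord.gbar => fun a b => dcomm b a
  | BWord.s => bstar
  | BWord.sbar => fun a b => bstar b a

/-- `evalW e a n` is the value `m(a₀ a₁ ⋯ a_n)` of the degree-`n` brace commutator word
`m = (e 0)(e 1)⋯(e (n-1))` on the arguments `a 0, …, a n`:
`m(a₀ ⋯ a_n) = (e 0)(a₀, (e 1)(a₁, …, (e (n-1))(a_{n-1}, a_n)⋯))`. -/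
def evalW : (ℕ → BWord) → (ℕ → A) → ℕ → A
  | _, a, 0 => a 0
  | e, a, (n+1) => evalX (e 0) (a 0) (evalW (fun i => e (i+1)) (fun i => a (i+1)) n)

/-- `Asub A t = A_{(t)}`, the subgroup of `(A,·)` generated by all values of brace commutator
words of degree `≥ t`. -/
def Asub (A : Type u) [SkewBrace A] (t : ℕ) : Set A :=
  dcl {x | ∃ s : ℕ, t ≤ s ∧ ∃ (e : ℕ → BWord) (a : ℕ → A), x = evalW e a s}

/-- `Sset A r = S_r(A)`, the set of all values of brace commutator words of degree exactly `r`
(`S_0(A) = A`). -/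
def Sset (A : Type u) [SkewBrace A] (r : ℕ) : Set A :=
  {x | ∃ (e : ℕ → BWord) (a : ℕ → A), x = evalW e a r}

/-- `cosetRel I a b` says that `b` lies in the coset `I · a`. -/
def cosetRel (I : Set A) (a b : A) : Prop := ∃ c ∈ I, b = dmul c a

/-- The class `I_n`: the maps `φ_m : (A/Ann_n(A))^{n+1} → A_{(n)}`,
`(Ann_n(A)a₁, …, Ann_n(A)a_{n+1}) ↦ m(a₁⋯a_{n+1})`, are well defined for every word `m` of
degree `n`. -/
def InClass (A : Type u) [SkewBrace A] (n : ℕ) : Prop :=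
  ∀ (e : ℕ → BWord) (a b : ℕ → A),
    (∀ i : ℕ, i ≤ n → cosetRel (AnnS A n) (a i) (b i)) →
    evalW e b n = evalW e a n

/-- A skew left brace `(A,·,∘)` is symmetric if `(A,∘,·)` is also a skew left brace, i.e.
`a · (b ∘ c) = (a · b) ∘ ā ∘ (a · c)`. -/
def IsSymmetric (A : Type u) [SkewBrace A] : Prop :=
  ∀ a b c : A, dmul a (cmul b c) = cmul (cmul (dmul a b) (cinv a)) (dmul a c)

/-- A sub-skew brace: a subset which is a subgroup of both `(A,·)` and `(A,∘)`. -/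
structure IsSubBrace (A : Type u) [SkewBrace A] (S : Set A) : Prop where
  ident_mem : ident ∈ S
  dmul_mem : ∀ {x y : A}, x ∈ S → y ∈ S → dmul x y ∈ S
  dinv_mem : ∀ {x : A}, x ∈ S → dinv x ∈ S
  cmul_mem : ∀ {x y : A}, x ∈ S → y ∈ S → cmul x y ∈ S
  cinv_mem : ∀ {x : A}, x ∈ S → cinv x ∈ S

/-- An ideal of a skew brace: a subgroup of `(A,·)`, normal in `(A,·)` and `(A,∘)`,
and invariant under all `λ_a`. -/
structure IsIdeal (A : Type u) [SkewBrace A] (I : Set A) : Prop where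
  ident_mem : ident ∈ I
  dmul_mem : ∀ {x y : A}, x ∈ I → y ∈ I → dmul x y ∈ I
  dinv_mem : ∀ {x : A}, x ∈ I → dinv x ∈ I
  dconj_mem : ∀ (a : A) {x : A}, x ∈ I → dmul (dmul a x) (dinv a) ∈ I
  cconj_mem : ∀ (a : A) {x : A}, x ∈ I → cmul (cmul a x) (cinv a) ∈ I
  lam_mem : ∀ (a : A) {x : A}, x ∈ I → lam a x ∈ I

/-- A homomorphism of skew braces. -/
structure IsBraceHom {A : Type u} {B : Type v} [SkewBrace A] [SkewBrace B] (f : A → B) : Prop where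
  map_dmul : ∀ x y : A, f (dmul x y) = dmul (f x) (f y)
  map_cmul : ∀ x y : A, f (cmul x y) = cmul (f x) (f y)

/-- The data of an isoclinism of skew braces along ideals `I` of `A` and `J` of `B`:
`ξ` induces a brace isomorphism `A/I → B/J` and `θ` restricts to a brace isomorphism
`Γ₂(A) → Γ₂(B)` compatible with the commutator and star maps. -/
structure IsoclinismData (A : Type u) (B : Type v) [SkewBrace A] [SkewBrace B]
    (I : Set A) (J : Set B) (ξ θ : A → B) : Prop where
  xi_resp : ∀ a a' : A, cosetRel I a a' ↔ cosetRel J (ξ a) (ξ a')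
  xi_surj : ∀ b : B, ∃ a : A, cosetRel J b (ξ a)
  xi_dmul : ∀ a a' : A, cosetRel J (dmul (ξ a) (ξ a')) (ξ (dmul a a'))
  xi_cmul : ∀ a a' : A, cosetRel J (cmul (ξ a) (ξ a')) (ξ (cmul a a'))
  theta_maps : ∀ x ∈ Gamma A 2, θ x ∈ Gamma B 2
  theta_inj : ∀ x ∈ Gamma A 2, ∀ y ∈ Gamma A 2, θ x = θ y → x = y
  theta_surj : ∀ y ∈ Gamma B 2, ∃ x ∈ Gamma A 2, θ x = y
  theta_dmul : ∀ x ∈ Gamma A 2, ∀ y ∈ Gamma A 2, θ (dmul x y) = dmul (θ x) (θ y)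
  theta_cmul : ∀ x ∈ Gamma A 2, ∀ y ∈ Gamma A 2, θ (cmul x y) = cmul (θ x) (θ y)
  compat_dcomm : ∀ a₁ a₂ : A, ∀ b₁ b₂ : B, cosetRel J b₁ (ξ a₁) → cosetRel J b₂ (ξ a₂) →
    θ (dcomm a₁ a₂) = dcomm b₁ b₂
  compat_star : ∀ a₁ a₂ : A, ∀ b₁ b₂ : B, cosetRel J b₁ (ξ a₁) → cosetRel J b₂ (ξ a₂) →
    θ (bstar a₁ a₂) = bstar b₁ b₂

/-- Isoclinism (1-isoclinism) of skew left braces. -/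
def Isoclinic (A : Type u) (B : Type v) [SkewBrace A] [SkewBrace B] : Prop :=
  ∃ ξ θ : A → B, IsoclinismData A B (AnnS A 1) (AnnS B 1) ξ θ

/-- The data of an `n`-isoclinism of skew braces: `ξ` induces a brace isomorphism
`A/Ann_n(A) → B/Ann_n(B)` and `θ` restricts to a brace isomorphism `A_{(n)} → B_{(n)}`
commuting with all brace commutator word maps of degree `n`. -/
structure IsoclinismDataN (A : Type u) (B : Type v) [SkewBrace A] [SkewBrace B]
    (n : ℕ) (ξ θ : A → B) : Prop where
  xi_resp : ∀ a a' : A, cosetRel (AnnS A n) a a' ↔ cosetRel (AnnS B n) (ξ a) (ξ a')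
  xi_surj : ∀ b : B, ∃ a : A, cosetRel (AnnS B n) b (ξ a)
  xi_dmul : ∀ a a' : A, cosetRel (AnnS B n) (dmul (ξ a) (ξ a')) (ξ (dmul a a'))
  xi_cmul : ∀ a a' : A, cosetRel (AnnS B n) (cmul (ξ a) (ξ a')) (ξ (cmul a a'))
  theta_maps : ∀ x ∈ Asub A n, θ x ∈ Asub B n
  theta_inj : ∀ x ∈ Asub A n, ∀ y ∈ Asub A n, θ x = θ y → x = y
  theta_surj : ∀ y ∈ Asub B n, ∃ x ∈ Asub A n, θ x = y
  theta_dmul : ∀ x ∈ Asub A n, ∀ y ∈ Asub A n, θ (dmul x y) = dmul (θ x) (θ y)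
  theta_cmul : ∀ x ∈ Asub A n, ∀ y ∈ Asub A n, θ (cmul x y) = cmul (θ x) (θ y)
  compat : ∀ (e : ℕ → BWord) (a : ℕ → A) (b : ℕ → B),
    (∀ i : ℕ, i ≤ n → cosetRel (AnnS B n) (b i) (ξ (a i))) →
    θ (evalW e a n) = evalW e b n

/-- `n`-isoclinism of skew left braces. -/
def IsoclinicN (A : Type u) (B : Type v) [SkewBrace A] [SkewBrace B] (n : ℕ) : Prop :=
  ∃ ξ θ : A → B, IsoclinismDataN A B n ξ θ

/-- The product set `S · T = {s · t : s ∈ S, t ∈ T}` in `(A,·)`. -/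
def setDProd (S T : Set A) : Set A := {x | ∃ s ∈ S, ∃ t ∈ T, x = dmul s t}

/-- The product set `S ∘ T = {s ∘ t : s ∈ S, t ∈ T}` in `(A,∘)`. -/
def setCProd (S T : Set A) : Set A := {x | ∃ s ∈ S, ∃ t ∈ T, x = cmul s t}

/-- The skew brace structure on a sub-skew brace. -/
def subBrace (S : Set A) (h : IsSubBrace A S) : SkewBrace S where
  dmul x y := ⟨dmul x.1 y.1, h.dmul_mem x.2 y.2⟩
  ident := ⟨ident, h.ident_mem⟩
  dinv x := ⟨dinv x.1, h.dinv_mem x.2⟩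
  cmul x y := ⟨cmul x.1 y.1, h.cmul_mem x.2 y.2⟩
  cinv x := ⟨cinv x.1, h.cinv_mem x.2⟩
  dmul_assoc a b c := Subtype.ext (dmul_assoc a.1 b.1 c.1)
  ident_dmul a := Subtype.ext (ident_dmul a.1)
  dmul_ident a := Subtype.ext (dmul_ident a.1)
  dinv_dmul a := Subtype.ext (dinv_dmul a.1)
  dmul_dinv a := Subtype.ext (dmul_dinv a.1)
  cmul_assoc a b c := Subtype.ext (cmul_assoc a.1 b.1 c.1)
  ident_cmul a := Subtype.ext (ident_cmul a.1)
  cmul_ident a := Subtype.ext (cmul_ident a.1)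
  cinv_cmul a := Subtype.ext (cinv_cmul a.1)
  cmul_cinv a := Subtype.ext (cmul_cinv a.1)
  compat a b c := Subtype.ext (compat a.1 b.1 c.1)

/-- The direct product of two skew braces, with componentwise operations. -/
instance prodBrace (A : Type u) (B : Type v) [SkewBrace A] [SkewBrace B] :
    SkewBrace (A × B) where
  dmul p q := (dmul p.1 q.1, dmul p.2 q.2)
  ident := (ident, ident)
  dinv p := (dinv p.1, dinv p.2)
  cmul p q := (cmul p.1 q.1, cmul p.2 q.2)
  cinv p := (cinv p.1, cinv p.2)
  dmul_assoc a b c := Prod.ext_iff.mpr ⟨dmul_assoc _ _ _, dmul_assoc _ _ _⟩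
  ident_dmul a := Prod.ext_iff.mpr ⟨ident_dmul _, ident_dmul _⟩
  dmul_ident a := Prod.ext_iff.mpr ⟨dmul_ident _, dmul_ident _⟩
  dinv_dmul a := Prod.ext_iff.mpr ⟨dinv_dmul _, dinv_dmul _⟩
  dmul_dinv a := Prod.ext_iff.mpr ⟨dmul_dinv _, dmul_dinv _⟩
  cmul_assoc a b c := Prod.ext_iff.mpr ⟨cmul_assoc _ _ _, cmul_assoc _ _ _⟩
  ident_cmul a := Prod.ext_iff.mpr ⟨ident_cmul _, ident_cmul _⟩
  cmul_ident a := Prod.ext_iff.mpr ⟨cmul_ident _, cmul_ident _⟩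
  cinv_cmul a := Prod.ext_iff.mpr ⟨cinv_cmul _, cinv_cmul _⟩
  cmul_cinv a := Prod.ext_iff.mpr ⟨cmul_cinv _, cmul_cinv _⟩
  compat a b c := Prod.ext_iff.mpr ⟨compat _ _ _, compat _ _ _⟩

end SkewBrace

namespace SkewBrace

/-- The group `(A,·)`. -/
abbrev dotGroup (A : Type u) [SkewBrace A] : Group A where
  mul := dmul
  one := ident
  inv := dinv
  mul_assoc := dmul_assoc
  one_mul := ident_dmul
  mul_one := dmul_ident
  inv_mul_cancel := dinv_dmul

section

attribute [local instance] dotGroup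

variable {A : Type u} [SkewBrace A]

theorem lam_eq (a b : A) : lam a b = a⁻¹ * cmul a b := rfl

theorem bstar_eq (a b : A) : bstar a b = lam a b * b⁻¹ := rfl

theorem dcomm_eq (a b : A) : dcomm a b = a * b * a⁻¹ * b⁻¹ := rfl

theorem cmul_eq (a b : A) : cmul a b = a * lam a b := by
  rw [lam_eq, mul_inv_cancel_left]

theorem lam_mul (a b c : A) : lam a (b * c) = lam a b * lam a c := by
  have h : cmul a (b * c) = cmul a b * a⁻¹ * cmul a c := compat a b c
  simp only [lam_eq, h, mul_assoc]

theorem lam_cmul (a b c : A) : lam (cmul a b) c = lam a (lam b c) := by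
  have h : cmul (cmul a b) c = cmul a (cmul b c) := cmul_assoc a b c
  rw [cmul_eq (cmul a b) c, cmul_eq b c, cmul_eq a (b * lam b c), lam_mul, cmul_eq a b,
    mul_assoc] at h
  rw [cmul_eq a b]
  exact mul_left_cancel (mul_left_cancel h)

theorem lam_ident (b : A) : lam (ident : A) b = b := by
  rw [lam_eq, ident_cmul, show (ident : A) = 1 from rfl, inv_one, one_mul]

/-- The automorphism `λ_a` of `(A,·)`. -/
def lamAut (a : A) : MulAut A where
  toFun := lam a
  invFun := lam (cinv a)
  left_inv b := by rw [← lam_cmul, cinv_cmul, lam_ident]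
  right_inv b := by rw [← lam_cmul, cmul_cinv, lam_ident]
  map_mul' := lam_mul a

theorem lamAut_cmul (a b : A) : lamAut (cmul a b) = lamAut a * lamAut b :=
  MulEquiv.ext (lam_cmul a b)

theorem bstar_eq_lamAut (a b : A) : bstar a b = lamAut a b * b⁻¹ := rfl

/-- In a symmetric skew brace, `λ` is an antihomomorphism from `(A,·)`. -/
theorem IsSymmetric.lamAut_mul (h : IsSymmetric A) (a b : A) :
    lamAut (a * b) = lamAut b * lamAut a := by
  ext d
  have key : a * cmul b (lam a d) = cmul (cmul (a * b) (cinv a)) (a * lam a d) := h a b (lam a d)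
  rw [← cmul_eq a d, cmul_assoc, ← cmul_assoc (cinv a), cinv_cmul, ident_cmul, cmul_eq,
    cmul_eq (a * b) d, mul_assoc] at key
  exact (mul_left_cancel (mul_left_cancel key)).symm

theorem IsSymmetric.lamAut_one (h : IsSymmetric A) : lamAut (1 : A) = 1 :=
  MulEquiv.ext lam_ident

theorem IsSymmetric.lamAut_inv (h : IsSymmetric A) (a : A) : lamAut a⁻¹ = (lamAut a)⁻¹ := by
  rw [eq_inv_iff_mul_eq_one, ← h.lamAut_mul, mul_inv_cancel, h.lamAut_one]

theorem IsSymmetric.lamAut_lamAut (h : IsSymmetric A) (a b : A) :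
    lamAut (lamAut a b) = lamAut a * lamAut b * (lamAut a)⁻¹ := by
  rw [eq_mul_inv_iff_mul_eq, ← h.lamAut_mul, ← lamAut_cmul, cmul_eq]
  rfl

theorem ident_mem_annS (n : ℕ) : (1 : A) ∈ AnnS A n := by
  induction n with
  | zero => exact rfl
  | succ n ih =>
    intro b
    have h₁ : bstar 1 b = (1 : A) := by
      rw [bstar_eq, show lam 1 b = b from lam_ident b, mul_inv_cancel]
    have h₂ : bstar b 1 = (1 : A) := by rw [bstar_eq_lamAut, map_one, inv_one, mul_one]
    have h₃ : dcomm 1 b = (1 : A) := by simp [dcomm_eq]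
    rw [h₁, h₂, h₃]
    exact ⟨ih, ih, ih⟩

theorem annS_subset_succ (n : ℕ) : AnnS A n ⊆ AnnS A (n + 1) := by
  induction n with
  | zero =>
    rintro a (rfl : a = 1)
    exact ident_mem_annS 1
  | succ n ih => exact fun a ha b => ⟨ih (ha b).1, ih (ha b).2.1, ih (ha b).2.2⟩

theorem bstar_mem_annS_pred {n : ℕ} {x : A} (hx : x ∈ AnnS A n) (a : A) :
    bstar a x ∈ AnnS A (n - 1) := by
  cases n with
  | zero =>
    obtain rfl : x = 1 := hx
    rw [bstar_eq_lamAut, map_one, inv_one, mul_one]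
    exact ident_mem_annS _
  | succ n => exact (hx a).2.1

theorem dcomm_mem_annS_pred {n : ℕ} {x : A} (hx : x ∈ AnnS A n) (a : A) :
    dcomm x a ∈ AnnS A (n - 1) := by
  cases n with
  | zero =>
    obtain rfl : x = 1 := hx
    simpa [dcomm_eq] using ident_mem_annS 0
  | succ n => exact (hx a).2.2

theorem annS_pred_subset (n : ℕ) : AnnS A (n - 1) ⊆ AnnS A n := by
  cases n with
  | zero => exact subset_rfl
  | succ n => exact annS_subset_succ n

/-- A subgroup of `(A,·)` whose underlying set is a term of the annihilator series is normal. -/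
theorem normal_of_coe_eq_annS {n : ℕ} {N : Subgroup A} (hN : (N : Set A) = AnnS A n) :
    N.Normal where
  conj_mem x hx g := by
    have hx' : x⁻¹ ∈ AnnS A n := hN ▸ N.inv_mem hx
    have h : dcomm x⁻¹ g ∈ N := by
      rw [← SetLike.mem_coe, hN]
      exact annS_pred_subset n (dcomm_mem_annS_pred hx' g)
    have := N.mul_mem hx h
    simpa [dcomm_eq, mul_assoc] using this

/-- A subgroup of `(A,·)` whose underlying set is a term of the annihilator series is stable
under all `λ_a`. -/
theorem lamAut_mem_of_coe_eq_annS {n : ℕ} {N : Subgroup A} (hN : (N : Set A) = AnnS A n) (a : A)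
    {x : A} (hx : x ∈ N) : lamAut a x ∈ N := by
  have h : bstar a x ∈ N := by
    rw [← SetLike.mem_coe, hN]
    rw [← SetLike.mem_coe, hN] at hx
    exact annS_pred_subset n (bstar_mem_annS_pred hx a)
  simpa [bstar_eq_lamAut] using N.mul_mem h hx

theorem mem_annS_succ_iff {n : ℕ} {N : Subgroup A} [N.Normal] (hN : (N : Set A) = AnnS A n)
    {a : A} : a ∈ AnnS A (n + 1) ↔ ∀ b : A, ((lamAut a b : A) : A ⧸ N) = b ∧
      ((lamAut b a : A) : A ⧸ N) = a ∧ (a : A ⧸ N) * b = b * a := by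
  have key (x : A) : x ∈ AnnS A n ↔ (x : A ⧸ N) = 1 := by
    rw [← hN, SetLike.mem_coe, QuotientGroup.eq_one_iff]
  refine forall_congr' fun b => ?_
  simp only [key, bstar_eq_lamAut, dcomm_eq, QuotientGroup.mk_mul, QuotientGroup.mk_inv,
    mul_inv_eq_iff_eq_mul, one_mul]

theorem IsSymmetric.exists_subgroup_coe_eq_annS (h : IsSymmetric A) (n : ℕ) :
    ∃ N : Subgroup A, (N : Set A) = AnnS A n := by
  induction n with
  | zero => exact ⟨⊥, rfl⟩
  | succ n ih =>
    obtain ⟨N, hN⟩ := ih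
    have := normal_of_coe_eq_annS hN
    refine ⟨⟨⟨⟨AnnS A (n + 1), ?_⟩, ident_mem_annS _⟩, ?_⟩, rfl⟩
    · intro a b ha hb
      rw [mem_annS_succ_iff hN] at ha hb ⊢
      intro c
      refine ⟨?_, ?_, ?_⟩
      · rw [h.lamAut_mul, MulAut.mul_apply, (hb _).1, (ha _).1]
      · rw [map_mul, QuotientGroup.mk_mul, (ha c).2.1, (hb c).2.1, QuotientGroup.mk_mul]
      · rw [QuotientGroup.mk_mul]
        exact (Commute.mul_left (ha c).2.2 (hb c).2.2)
    · intro a ha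
      change a ∈ AnnS A (n + 1) at ha
      change a⁻¹ ∈ AnnS A (n + 1)
      rw [mem_annS_succ_iff hN] at ha ⊢
      intro c
      refine ⟨?_, ?_, ?_⟩
      · rw [h.lamAut_inv]
        simpa using (ha ((lamAut a)⁻¹ c)).1.symm
      · rw [map_inv, QuotientGroup.mk_inv, (ha c).2.1, QuotientGroup.mk_inv]
      · rw [QuotientGroup.mk_inv]
        exact Commute.inv_left (ha c).2.2

/-- The term `Ann_n(A)` of the annihilator series as a subgroup of `(A,·)`. -/
noncomputable def annSubgroup (h : IsSymmetric A) (n : ℕ) : Subgroup A :=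
  (h.exists_subgroup_coe_eq_annS n).choose

theorem coe_annSubgroup (h : IsSymmetric A) (n : ℕ) : (annSubgroup h n : Set A) = AnnS A n :=
  (h.exists_subgroup_coe_eq_annS n).choose_spec

instance (h : IsSymmetric A) (n : ℕ) : (annSubgroup h n).Normal :=
  normal_of_coe_eq_annS (coe_annSubgroup h n)

theorem mem_annSubgroup {h : IsSymmetric A} {n : ℕ} {x : A} :
    x ∈ annSubgroup h n ↔ x ∈ AnnS A n := by
  rw [← coe_annSubgroup h n, SetLike.mem_coe]

theorem bstar_mem_annS_iff (h : IsSymmetric A) {n : ℕ} {a x : A} :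
    bstar a x ∈ AnnS A n ↔ ((lamAut a x : A) : A ⧸ annSubgroup h n) = x := by
  rw [← mem_annSubgroup (h := h), ← QuotientGroup.eq_one_iff, bstar_eq_lamAut,
    QuotientGroup.mk_mul, QuotientGroup.mk_inv, mul_inv_eq_one]

theorem lamAut_mem_annSubgroup_iff {h : IsSymmetric A} {n : ℕ} {a x : A} :
    lamAut a x ∈ annSubgroup h n ↔ x ∈ annSubgroup h n := by
  refine ⟨fun hx => ?_, lamAut_mem_of_coe_eq_annS (coe_annSubgroup h n) a⟩
  have := lamAut_mem_of_coe_eq_annS (coe_annSubgroup h n) a⁻¹ hx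
  rwa [h.lamAut_inv, MulAut.inv_apply_self] at this

/-- The subgroup of the elements `v` such that `λ_v` acts trivially on
`Ann_s(A)/Ann_{s-r}(A)` for all `s`. -/
def actsTrivially (h : IsSymmetric A) (r : ℕ) : Subgroup A where
  carrier := {v | ∀ s, ∀ x ∈ annSubgroup h s,
    ((lamAut v x : A) : A ⧸ annSubgroup h (s - r)) = x}
  one_mem' s x _ := by rw [h.lamAut_one, MulAut.one_apply]
  mul_mem' := by
    intro v w hv hw s x hx
    rw [h.lamAut_mul, MulAut.mul_apply, hw s _ (lamAut_mem_annSubgroup_iff.2 hx), hv s x hx]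
  inv_mem' := by
    intro v hv s x hx
    have := hv s (lamAut v⁻¹ x) (lamAut_mem_annSubgroup_iff.2 hx)
    rw [h.lamAut_inv, MulAut.apply_inv_self] at this
    rw [h.lamAut_inv, this]

theorem mem_actsTrivially_iff {h : IsSymmetric A} {r : ℕ} {v : A} :
    v ∈ actsTrivially h r ↔ ∀ s, ∀ x ∈ AnnS A s, bstar v x ∈ AnnS A (s - r) := by
  refine forall_congr' fun s => forall_congr' fun x => ?_
  rw [mem_annSubgroup, bstar_mem_annS_iff]

/-- The automorphisms `λ_a` and `λ_v` commute on `Ann_s(A)/Ann_{s-(r+1)}(A)` if `λ_v` acts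
trivially on each `Ann_s(A)/Ann_{s-r}(A)`. -/
theorem lamAut_lamAut_comm {h : IsSymmetric A} {r : ℕ} {v : A} (hv : v ∈ actsTrivially h r)
    (a : A) (s : ℕ) {x : A} (hx : x ∈ annSubgroup h s) :
    ((lamAut a (lamAut v x) : A) : A ⧸ annSubgroup h (s - (r + 1))) = lamAut v (lamAut a x) := by
  have hc : bstar v x ∈ AnnS A (s - r) :=
    mem_actsTrivially_iff.1 hv s x (mem_annSubgroup.1 hx)
  have hd : bstar a x ∈ annSubgroup h (s - 1) :=
    mem_annSubgroup.2 (bstar_mem_annS_pred (mem_annSubgroup.1 hx) a)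
  have h₁ := (bstar_mem_annS_iff h).1 (bstar_mem_annS_pred hc a)
  have h₂ := hv _ _ hd
  have h₃ := dcomm_mem_annS_pred hc (bstar a x)
  rw [← mem_annSubgroup (h := h), ← QuotientGroup.eq_one_iff, dcomm_eq] at h₃
  simp only [QuotientGroup.mk_mul, QuotientGroup.mk_inv, mul_inv_eq_iff_eq_mul,
    one_mul] at h₃
  rw [Nat.sub_sub] at h₁ h₂ h₃
  rw [Nat.add_comm 1 r] at h₂
  have e₁ : lamAut v x = bstar v x * x := by rw [bstar_eq_lamAut, inv_mul_cancel_right]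
  have e₂ : lamAut a x = bstar a x * x := by rw [bstar_eq_lamAut, inv_mul_cancel_right]
  rw [e₁, e₂, map_mul, map_mul, QuotientGroup.mk_mul, QuotientGroup.mk_mul, h₁, h₂, e₁, e₂,
    QuotientGroup.mk_mul, QuotientGroup.mk_mul, ← mul_assoc, ← mul_assoc, h₃]

/-- If `λ_c = [λ_f, λ_g]` where `λ_f` and `λ_g` commute on each `Ann_s(A)/Ann_{s-r}(A)`,
then `λ_c` acts trivially on these quotients. -/
theorem mem_actsTrivially_of_lamAut_eq {h : IsSymmetric A} {r : ℕ} {c f g : A}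
    (hc : lamAut c = lamAut f * lamAut g * (lamAut f)⁻¹ * (lamAut g)⁻¹)
    (hfg : ∀ s, ∀ x ∈ annSubgroup h s,
      ((lamAut f (lamAut g x) : A) : A ⧸ annSubgroup h (s - r)) = lamAut g (lamAut f x)) :
    c ∈ actsTrivially h r := by
  intro s x hx
  have hy : lamAut f⁻¹ (lamAut g⁻¹ x) ∈ annSubgroup h s :=
    lamAut_mem_annSubgroup_iff.2 (lamAut_mem_annSubgroup_iff.2 hx)
  have := hfg s _ hy
  rw [h.lamAut_inv, h.lamAut_inv, MulAut.apply_inv_self, MulAut.apply_inv_self] at this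
  rw [hc]
  exact this

theorem gamma_succ_subset_actsTrivially (h : IsSymmetric A) (r : ℕ) :
    Gamma A (r + 1) ⊆ actsTrivially h (r + 1) := by
  induction r with
  | zero => exact fun v _ => mem_actsTrivially_iff.2 fun s x hx => bstar_mem_annS_pred hx v
  | succ r ih =>
    intro v hv
    change dclosure _ v at hv
    induction hv with
    | one => exact Subgroup.one_mem _
    | mul _ _ hx hy => exact Subgroup.mul_mem _ hx hy
    | inv _ hx => exact Subgroup.inv_mem _ hx
    | mem hx =>
      obtain (⟨a, -, b, hb, rfl⟩ | ⟨b, hb, a, -, rfl⟩) | ⟨a, -, b, hb, rfl⟩ := hx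
      · refine mem_actsTrivially_of_lamAut_eq (f := b⁻¹) (g := a) ?_ fun s x hx =>
          (lamAut_lamAut_comm (inv_mem (ih hb)) a s hx).symm
        rw [bstar_eq_lamAut, h.lamAut_mul, h.lamAut_lamAut]
        simp only [h.lamAut_inv, inv_inv, mul_assoc]
      · refine mem_actsTrivially_of_lamAut_eq (f := a⁻¹) (g := b) ?_ fun s x hx =>
          lamAut_lamAut_comm (ih hb) _ s hx
        rw [bstar_eq_lamAut, h.lamAut_mul, h.lamAut_lamAut]
        simp only [h.lamAut_inv, inv_inv, mul_assoc]
      · refine mem_actsTrivially_of_lamAut_eq (f := b⁻¹) (g := a⁻¹) ?_ fun s x hx =>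
          (lamAut_lamAut_comm (inv_mem (ih hb)) _ s hx).symm
        rw [dcomm_eq]
        simp only [h.lamAut_mul, h.lamAut_inv, inv_inv, mul_assoc]

end

end SkewBrace

open SkewBrace in
/-- Let `A` be a symmetric skew brace. Then for all `s ≥ r ≥ 1`, all `v ∈ Γ_r(A)` and all
`x ∈ Ann_s(A)`, one has `v * x ∈ Ann_{s-r}(A)`. -/
theorem bstar_mem_annS_of_symmetric (A : Type u) [SkewBrace A] (h : IsSymmetric A)
    (s r : ℕ) (hr : 1 ≤ r) (hrs : r ≤ s)
    (v : A) (hv : v ∈ Gamma A r) (x : A) (hx : x ∈ AnnS A s) :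
    bstar v x ∈ AnnS A (s - r) := by
  obtain ⟨r, rfl⟩ := Nat.exists_eq_add_of_le' hr
  exact mem_actsTrivially_iff.1 (gamma_succ_subset_actsTrivially h r hv) s x hx
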